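/- arXiv:1401.0542 — 4 statements merged into one kernel-verified Lean document; each statement's English description precedes it below -/
import Mathlib

section
/- Let N ≥ 1 and 0 ≤ M ≤ N−1 be integers and let ρ : ℝ × ℝ → ℝ be smooth. For w ∈ ℝ write ρ_w(y) = ρ(w,y). Suppose (a) ρ_w belongs to 𝓜_N for every w; (b) for each integer n ≥ 0, the seminorm ‖ρ_w‖_{N,n} is bounded uniformly for w in any compact subset of ℝ; and (c) ∂_y^m ρ(w,0) = 0 for every w ∈ ℝ and every integer m with 0 ≤ m ≤ M. Then for every integer n ≥ 0 and every compact set K ⊆ ℝ, sup_{w∈K} σ^M ‖ρ_w(·/σ)‖_{N,n} → 0 as σ → ∞, where ρ_w(·/σ) denotes the function y ↦ ρ_w(y/σ). -/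
open MeasureTheory Real Filter Topology

noncomputable section

/-- `ψ` belongs to the class `𝓜_N`: it is smooth and for every `n ≥ 0` the seminorm
`‖ψ‖_{N,n} = sup_x (1+|x|)^{-(N-n)} |ψ^{(n)}(x)|` is finite. -/
def MClass (N : ℕ) (ψ : ℝ → ℝ) : Prop :=
  ContDiff ℝ (⊤ : ℕ∞) ψ ∧ ∀ n : ℕ, ∃ C : ℝ,
    ∀ x : ℝ, (1 + |x|) ^ ((n : ℤ) - (N : ℤ)) * |iteratedDeriv n ψ x| ≤ C

/-- If the first `m` derivatives of a smooth `f` vanish at `0`, a bound `C (1+|z|)^q` on the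
`m`-th derivative integrates to a bound `C |z|^j (1+|z|)^q` on the derivative of order `m - j`. -/
lemma abs_iteratedDeriv_le_of_vanishing {f : ℝ → ℝ} (hf : ContDiff ℝ (⊤ : ℕ∞) f) {C : ℝ}
    (hC : 0 ≤ C) {m q : ℕ} (h0 : ∀ k < m, iteratedDeriv k f 0 = 0)
    (hm : ∀ z, |iteratedDeriv m f z| ≤ C * (1 + |z|) ^ q) (j n : ℕ) (hnj : n + j = m) (z : ℝ) :
    |iteratedDeriv n f z| ≤ C * (|z| ^ j * (1 + |z|) ^ q) := by
  induction j generalizing n z with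
  | zero =>
    obtain rfl : n = m := by omega
    simpa using hm z
  | succ j ih =>
    have hd : Differentiable ℝ (iteratedDeriv n f) :=
      hf.differentiable_iteratedDeriv n (by exact_mod_cast ENat.natCast_lt_top n)
    have hbound : ∀ x ∈ Set.Icc (-|z|) |z|,
        ‖deriv (iteratedDeriv n f) x‖ ≤ C * (|z| ^ j * (1 + |z|) ^ q) := by
      intro x hx
      have hxz : |x| ≤ |z| := abs_le.2 hx
      rw [← iteratedDeriv_succ, Real.norm_eq_abs]
      refine (ih (n + 1) (by omega) x).trans ?_
      gcongr
    have h := (convex_Icc (-|z|) |z|).norm_image_sub_le_of_norm_deriv_le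
      (fun x _ => hd x) hbound (x := 0) (y := z) (by simp) (abs_le.1 le_rfl)
    rw [h0 n (by omega), sub_zero, sub_zero, Real.norm_eq_abs, Real.norm_eq_abs] at h
    exact h.trans_eq (by ring)

/-- The iterated derivatives of a dilate of a smooth function. -/
lemma iteratedDeriv_comp_div_const {f : ℝ → ℝ} (hf : ContDiff ℝ (⊤ : ℕ∞) f) (n : ℕ) (σ y : ℝ) :
    iteratedDeriv n (fun x => f (x / σ)) y = iteratedDeriv n f (y / σ) / σ ^ n := by
  have h := congrFun (iteratedDeriv_comp_const_mul (n := n)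
    (hf.of_le (by exact_mod_cast le_top)) σ⁻¹) y
  simp only [inv_mul_eq_div] at h
  rw [h, inv_pow, inv_mul_eq_div]

/-- Decay of the weighted `n`-th derivative of a dilate, for `n` at most the vanishing order. -/
lemma scaled_seminorm_le_of_vanishing {f : ℝ → ℝ} (hf : ContDiff ℝ (⊤ : ℕ∞) f) {C : ℝ}
    (hC : 0 ≤ C) {M N n : ℕ} (hMN : M + 1 ≤ N) (hn : n ≤ M + 1)
    (h0 : ∀ k ≤ M, iteratedDeriv k f 0 = 0)
    (hb : ∀ z, (1 + |z|) ^ (((M + 1 : ℕ) : ℤ) - (N : ℤ)) * |iteratedDeriv (M + 1) f z| ≤ C)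
    {σ : ℝ} (hσ : 1 ≤ σ) (y : ℝ) :
    σ ^ M * ((1 + |y|) ^ ((n : ℤ) - (N : ℤ)) * |iteratedDeriv n (fun x => f (x / σ)) y|)
      ≤ C / σ := by
  obtain ⟨q, rfl⟩ := Nat.exists_eq_add_of_le hMN
  obtain ⟨j, hj⟩ := Nat.exists_eq_add_of_le hn
  have hσ0 : 0 < σ := by linarith
  have hm : ∀ z, |iteratedDeriv (M + 1) f z| ≤ C * (1 + |z|) ^ q := by
    intro z
    have hz : 0 < 1 + |z| := by positivity
    have h := hb z
    rw [show ((M + 1 : ℕ) : ℤ) - ((M + 1 + q : ℕ) : ℤ) = -(q : ℤ) by push_cast; ring,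
      zpow_neg, zpow_natCast, inv_mul_le_iff₀ (by positivity)] at h
    linarith
  have h := abs_iteratedDeriv_le_of_vanishing hf hC (fun k hk => h0 k (by omega)) hm j n
    hj.symm (y / σ)
  have ha : 0 < 1 + |y| := by positivity
  have hyσ : |y / σ| = |y| / σ := by rw [abs_div, abs_of_pos hσ0]
  have hdiv : |y| / σ ≤ |y| := div_le_self (abs_nonneg y) hσ
  have h' : |iteratedDeriv n f (y / σ)| ≤ C * (((1 + |y|) / σ) ^ j * (1 + |y|) ^ q) := by
    refine h.trans ?_
    rw [hyσ]
    gcongr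
    linarith
  rw [iteratedDeriv_comp_div_const hf, abs_div, abs_of_pos (pow_pos hσ0 n),
    show (n : ℤ) - ((M + 1 + q : ℕ) : ℤ) = -((j + q : ℕ) : ℤ) by rw [hj]; push_cast; ring,
    zpow_neg, zpow_natCast]
  calc σ ^ M * (((1 + |y|) ^ (j + q))⁻¹ * (|iteratedDeriv n f (y / σ)| / σ ^ n))
      ≤ σ ^ M * (((1 + |y|) ^ (j + q))⁻¹ *
          (C * (((1 + |y|) / σ) ^ j * (1 + |y|) ^ q) / σ ^ n)) := by gcongr
    _ = C * σ ^ M / σ ^ (n + j) := by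
      rw [div_pow, pow_add, pow_add]
      field_simp
    _ = C / σ := by
      rw [← hj, pow_succ]
      field_simp

/-- Decay of the weighted `n`-th derivative of a dilate, for `n` beyond the vanishing order. -/
lemma scaled_seminorm_le_of_lt {f : ℝ → ℝ} (hf : ContDiff ℝ (⊤ : ℕ∞) f) {C : ℝ}
    (hC : 0 ≤ C) {M N n : ℕ} (hMN : M + 1 ≤ N) (hn : M + 1 ≤ n)
    (hb : ∀ z, (1 + |z|) ^ ((n : ℤ) - (N : ℤ)) * |iteratedDeriv n f z| ≤ C)
    {σ : ℝ} (hσ : 1 ≤ σ) (y : ℝ) :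
    σ ^ M * ((1 + |y|) ^ ((n : ℤ) - (N : ℤ)) * |iteratedDeriv n (fun x => f (x / σ)) y|)
      ≤ C / σ := by
  have hσ0 : 0 < σ := by linarith
  have ha : 0 < 1 + |y| := by positivity
  have hdecay : ∀ k, M + 1 ≤ k → C * σ ^ M / σ ^ k ≤ C / σ := by
    intro k hk
    rw [div_le_div_iff₀ (by positivity) hσ0, mul_assoc, ← pow_succ]
    gcongr
  have hyσ : |y / σ| = |y| / σ := by rw [abs_div, abs_of_pos hσ0]
  have hdiv : |y| / σ ≤ |y| := div_le_self (abs_nonneg y) hσ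
  have hz : 0 < 1 + |y| / σ := by positivity
  have h := hb (y / σ)
  rw [iteratedDeriv_comp_div_const hf, abs_div, abs_of_pos (pow_pos hσ0 n)]
  rw [hyσ] at h
  rcases le_total n N with hnN | hnN
  · obtain ⟨j, rfl⟩ := Nat.exists_eq_add_of_le hnN
    rw [show (n : ℤ) - ((n + j : ℕ) : ℤ) = -(j : ℤ) by push_cast; ring,
      zpow_neg, zpow_natCast] at h ⊢
    rw [inv_mul_le_iff₀ (by positivity)] at h
    have h' : |iteratedDeriv n f (y / σ)| ≤ (1 + |y|) ^ j * C := by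
      refine h.trans ?_
      gcongr
    calc σ ^ M * (((1 + |y|) ^ j)⁻¹ * (|iteratedDeriv n f (y / σ)| / σ ^ n))
        ≤ σ ^ M * (((1 + |y|) ^ j)⁻¹ * ((1 + |y|) ^ j * C / σ ^ n)) := by gcongr
      _ = C * σ ^ M / σ ^ n := by field_simp
      _ ≤ C / σ := hdecay n hn
  · obtain ⟨i, rfl⟩ := Nat.exists_eq_add_of_le hnN
    rw [show ((N + i : ℕ) : ℤ) - (N : ℤ) = (i : ℤ) by push_cast; ring, zpow_natCast] at h ⊢
    have hle : 1 + |y| ≤ σ * (1 + |y| / σ) := by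
      rw [mul_add, mul_div_cancel₀ _ hσ0.ne']
      linarith
    calc σ ^ M * ((1 + |y|) ^ i * (|iteratedDeriv (N + i) f (y / σ)| / σ ^ (N + i)))
        ≤ σ ^ M * ((σ * (1 + |y| / σ)) ^ i *
            (|iteratedDeriv (N + i) f (y / σ)| / σ ^ (N + i))) := by gcongr
      _ = ((1 + |y| / σ) ^ i * |iteratedDeriv (N + i) f (y / σ)|) * σ ^ M / σ ^ N := by
        rw [mul_pow, pow_add]
        field_simp
      _ ≤ C * σ ^ M / σ ^ N := by gcongr
      _ ≤ C / σ := hdecay N hMN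

/-- **Taylor-remainder lemma for finitely many moments** (Lemma 11): if `ρ(w,y)` is
smooth, each slice `ρ_w ∈ 𝓜_N` with seminorms locally uniformly bounded in `w`, and the
`y`-derivatives of order `≤ M` vanish at `y = 0`, then `σ^M ‖ρ_w(·/σ)‖_{N,n} → 0` as
`σ → ∞`, locally uniformly in `w`. -/
theorem rho_lemma_finite_moments (N : ℕ) (hN : 1 ≤ N) (M : ℕ) (hM : M ≤ N - 1)
    (ρ : ℝ × ℝ → ℝ) (hsmooth : ContDiff ℝ (⊤ : ℕ∞) ρ)
    (ha : ∀ w : ℝ, MClass N (fun y => ρ (w, y)))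
    (hb : ∀ n : ℕ, ∀ K : Set ℝ, IsCompact K → ∃ C : ℝ, ∀ w ∈ K, ∀ y : ℝ,
      (1 + |y|) ^ ((n : ℤ) - (N : ℤ)) * |iteratedDeriv n (fun y' => ρ (w, y')) y| ≤ C)
    (hc : ∀ w : ℝ, ∀ m : ℕ, m ≤ M → iteratedDeriv m (fun y => ρ (w, y)) 0 = 0) :
    ∀ n : ℕ, ∀ K : Set ℝ, IsCompact K → ∀ ε > (0 : ℝ),
      ∀ᶠ σ : ℝ in atTop, ∀ w ∈ K, ∀ y : ℝ,
        σ ^ M * ((1 + |y|) ^ ((n : ℤ) - (N : ℤ)) *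
          |iteratedDeriv n (fun y' => ρ (w, y' / σ)) y|) < ε := by
  intro n K hK ε hε
  obtain ⟨C₁, hC₁⟩ := hb n K hK
  obtain ⟨C₂, hC₂⟩ := hb (M + 1) K hK
  have hMN : M + 1 ≤ N := by omega
  set C := max |C₁| |C₂|
  have hC : 0 ≤ C := (abs_nonneg C₁).trans (le_max_left _ _)
  filter_upwards [eventually_ge_atTop 1, eventually_gt_atTop (C / ε)] with σ hσ hσC w hw y
  have hsmall : C / σ < ε := by
    rw [div_lt_iff₀ hε] at hσC
    rw [div_lt_iff₀ (by linarith)]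
    linarith
  refine lt_of_le_of_lt ?_ hsmall
  rcases le_total n (M + 1) with hn | hn
  · exact scaled_seminorm_le_of_vanishing (ha w).1 hC hMN hn (hc w)
      (fun z => (hC₂ w hw z).trans ((le_abs_self C₂).trans (le_max_right _ _))) hσ y
  · exact scaled_seminorm_le_of_lt (ha w).1 hC hMN hn
      (fun z => (hC₁ w hw z).trans ((le_abs_self C₁).trans (le_max_left _ _))) hσ y
end
end

section
/- (Gaussian moment expansion with finitely many moments) Let N ≥ 1 be an integer and let f : ℝ → ℝ be measurable with ∫(1+|x|)^N |f(x)| dx < ∞; set μ_n = ∫ x^n f(x) dx. Then for every integer M with 0 ≤ M ≤ N−1 and every compact set K ⊆ ℝ, sup_{w∈K} | σ^{M+1} ( (f*G_σ)(σw) − Σ_{n=0}^{M} (μ_n/n!) σ^{−n−1} H_n(w) G(w) ) | → 0 as σ → ∞. -/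
open MeasureTheory Real Filter Topology

noncomputable section

/-- The standard Gaussian `G(x) = (2π)^{-1/2} e^{-x²/2}`. -/
def gauss (x : ℝ) : ℝ := (Real.sqrt (2 * Real.pi))⁻¹ * Real.exp (-x ^ 2 / 2)

/-- The Gaussian of width `σ`: `G_σ(x) = σ⁻¹ G(x/σ)`. -/
def gaussScaled (σ x : ℝ) : ℝ := σ⁻¹ * gauss (x / σ)

/-- The `n`-th probabilists' Hermite polynomial, evaluated at a real number. -/
def hermiteR (n : ℕ) (x : ℝ) : ℝ := Polynomial.aeval x (Polynomial.hermite n)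

/-- The `n`-th moment `μ_n = ∫ x^n f(x) dx`. -/
def moment1 (f : ℝ → ℝ) (n : ℕ) : ℝ := ∫ x : ℝ, x ^ n * f x

/-- The `n`-th derivative of the Gaussian up to sign: `H_n(x) G(x)`. -/
def hermiteGauss (n : ℕ) (x : ℝ) : ℝ := hermiteR n x * gauss x

theorem hasDerivAt_gauss (x : ℝ) : HasDerivAt gauss (-x * gauss x) x := by
  have h : HasDerivAt (fun y : ℝ => -y ^ 2 / 2) (-x) x := by
    exact ((((hasDerivAt_id x).pow 2).neg).div_const 2).congr_deriv (by simp; ring)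
  refine (h.exp.const_mul (Real.sqrt (2 * Real.pi))⁻¹).congr_deriv ?_
  unfold gauss
  ring

theorem hasDerivAt_hermiteGauss (n : ℕ) (x : ℝ) :
    HasDerivAt (hermiteGauss n) (-hermiteGauss (n + 1) x) x := by
  refine ((Polynomial.hasDerivAt_aeval (Polynomial.hermite n) x).mul
    (hasDerivAt_gauss x)).congr_deriv ?_
  simp only [hermiteGauss, hermiteR, Polynomial.hermite_succ, map_sub, map_mul,
    Polynomial.aeval_X]
  ring

theorem continuous_gauss : Continuous gauss := by
  unfold gauss
  fun_prop

theorem abs_pow_mul_exp_neg_sq_le (n : ℕ) (x : ℝ) :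
    |x| ^ n * Real.exp (-x ^ 2 / 2) ≤ n.factorial * Real.exp (1 / 2) := by
  have h := Real.pow_div_factorial_le_exp |x| (abs_nonneg x) n
  rw [div_le_iff₀' (by positivity)] at h
  calc |x| ^ n * Real.exp (-x ^ 2 / 2)
      ≤ n.factorial * Real.exp |x| * Real.exp (-x ^ 2 / 2) := by gcongr
    _ = n.factorial * Real.exp (|x| + -x ^ 2 / 2) := by rw [mul_assoc, Real.exp_add]
    _ ≤ n.factorial * Real.exp (1 / 2) := by
      gcongr
      nlinarith [sq_nonneg (|x| - 1), sq_abs x]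

theorem exists_abs_hermiteGauss_le (n : ℕ) : ∃ C, ∀ x, |hermiteGauss n x| ≤ C := by
  set p := Polynomial.hermite n
  refine ⟨(Real.sqrt (2 * Real.pi))⁻¹ * ∑ i ∈ Finset.range (p.natDegree + 1),
    |(p.coeff i : ℝ)| * (i.factorial * Real.exp (1 / 2)), fun x => ?_⟩
  have h : hermiteGauss n x = (Real.sqrt (2 * Real.pi))⁻¹ *
      ∑ i ∈ Finset.range (p.natDegree + 1),
        (p.coeff i : ℝ) * (x ^ i * Real.exp (-x ^ 2 / 2)) := by
    simp only [hermiteGauss, hermiteR, gauss, Polynomial.aeval_eq_sum_range, zsmul_eq_mul,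
      Finset.mul_sum, Finset.sum_mul, p]
    exact Finset.sum_congr rfl fun i _ => by ring
  rw [h, abs_mul, abs_of_nonneg (by positivity : 0 ≤ (Real.sqrt (2 * Real.pi))⁻¹)]
  gcongr
  refine (Finset.abs_sum_le_sum_abs _ _).trans (Finset.sum_le_sum fun i _ => ?_)
  rw [abs_mul, abs_mul, abs_pow, Real.abs_exp]
  exact mul_le_mul_of_nonneg_left (abs_pow_mul_exp_neg_sq_le i x) (abs_nonneg _)

/-- A Taylor bound for a sequence of functions with `g n' = -g (n + 1)`. -/
theorem abs_sub_taylor_sum_le {g : ℕ → ℝ → ℝ}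
    (hg : ∀ n x, HasDerivAt (g n) (-g (n + 1) x) x) (m k : ℕ) {C : ℝ}
    (hC : ∀ x, |g (k + m) x| ≤ C) (w h : ℝ) :
    |g k (w - h) - ∑ n ∈ Finset.range m, h ^ n / n.factorial * g (k + n) w| ≤ C * |h| ^ m := by
  induction m generalizing k h with
  | zero => simpa using hC (w - h)
  | succ m ih =>
    set F : ℝ → ℝ := fun t =>
      g k (w - t) - ∑ n ∈ Finset.range (m + 1), t ^ n / n.factorial * g (k + n) w with hF
    have hC0 : 0 ≤ C := (abs_nonneg _).trans (hC 0)
    have hderiv : ∀ t, HasDerivAt F (g (k + 1) (w - t) -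
        ∑ n ∈ Finset.range m, t ^ n / n.factorial * g (k + 1 + n) w) t := by
      intro t
      have hleft : HasDerivAt (fun t => g k (w - t)) (g (k + 1) (w - t)) t := by
        exact ((hg k (w - t)).comp t ((hasDerivAt_id t).const_sub w)).congr_deriv (by simp)
      refine hleft.sub ?_
      simp only [Finset.sum_range_succ' _ m, pow_zero]
      refine HasDerivAt.add_const _ (HasDerivAt.fun_sum fun n _ => ?_)
      refine ((((hasDerivAt_id t).pow (n + 1)).div_const ((n + 1).factorial : ℝ)).mul_const
        (g (k + (n + 1)) w)).congr_deriv ?_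
      rw [Nat.factorial_succ, show k + 1 + n = k + (n + 1) by ring]
      push_cast
      simp only [id, mul_one]
      field_simp
    have hbound : ∀ t ∈ Set.uIcc 0 h, ‖g (k + 1) (w - t) -
        ∑ n ∈ Finset.range m, t ^ n / n.factorial * g (k + 1 + n) w‖ ≤ C * |h| ^ m := by
      intro t ht
      have ht' : |t| ≤ |h| := by simpa using Set.abs_sub_left_of_mem_uIcc ht
      refine (ih (k + 1) (fun x => ?_) t).trans (by gcongr)
      rw [show k + 1 + m = k + (m + 1) by ring]
      exact hC x
    have hmvt := (convex_uIcc 0 h).norm_image_sub_le_of_norm_hasDerivWithin_le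
      (fun t _ => (hderiv t).hasDerivWithinAt) hbound Set.left_mem_uIcc Set.right_mem_uIcc
    have hF0 : F 0 = 0 := by simp [hF, Finset.sum_range_succ']
    rw [hF0, sub_zero, sub_zero, Real.norm_eq_abs, Real.norm_eq_abs] at hmvt
    exact hmvt.trans_eq (by ring)

theorem integrable_pow_mul_of_integrable_weight {N : ℕ} {f : ℝ → ℝ} (hmeas : Measurable f)
    (hint : Integrable (fun x : ℝ => (1 + |x|) ^ N * |f x|)) {n : ℕ} (hn : n ≤ N) :
    Integrable (fun x : ℝ => x ^ n * f x) := by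
  refine hint.mono' (by fun_prop) (ae_of_all _ fun x => ?_)
  rw [Real.norm_eq_abs, abs_mul, abs_pow]
  gcongr
  calc |x| ^ n ≤ (1 + |x|) ^ n := by gcongr; linarith
    _ ≤ (1 + |x|) ^ N := pow_le_pow_right₀ (by linarith [abs_nonneg x]) hn

theorem integrable_mul_gauss {f : ℝ → ℝ} (hf : Integrable f) (w σ : ℝ) :
    Integrable (fun y => f y * gauss (w - y / σ)) := by
  obtain ⟨C, hC⟩ := exists_abs_hermiteGauss_le 0
  refine hf.mul_bdd (c := C) ?_ (ae_of_all _ fun y => ?_)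
  · exact (continuous_gauss.comp (by fun_prop)).aestronglyMeasurable
  · simpa [hermiteGauss, hermiteR] using hC (w - y / σ)

/-- **Gaussian moment expansion with finitely many moments** (Corollary 12): if `f` has
finite moments through order `N`, then for any `M ≤ N - 1` the Hermite moment expansion
of `(f * G_σ)(σw)` has error `o(σ^{-M-1})`, locally uniformly in `w`. -/
theorem gaussian_finite_moment_expansion (N : ℕ) (hN : 1 ≤ N)
    (f : ℝ → ℝ) (hmeas : Measurable f)
    (hint : Integrable (fun x : ℝ => (1 + |x|) ^ N * |f x|))
    (M : ℕ) (hM : M ≤ N - 1) (K : Set ℝ) (hK : IsCompact K) :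
    ∀ ε > (0 : ℝ), ∀ᶠ σ : ℝ in atTop, ∀ w ∈ K,
      |σ ^ (M + 1) * ((∫ y : ℝ, f y * gaussScaled σ (σ * w - y)) -
        ∑ n ∈ Finset.range (M + 1),
          (moment1 f n / (Nat.factorial n : ℝ)) * σ ^ (-(n : ℤ) - 1) *
            hermiteR n w * gauss w)| < ε := by
  have hpow : ∀ n ≤ M + 1, Integrable (fun x : ℝ => x ^ n * f x) := fun n hn =>
    integrable_pow_mul_of_integrable_weight hmeas hint (by omega)
  have hf : Integrable f := by simpa using hpow 0 (by omega)
  obtain ⟨C, hC⟩ := exists_abs_hermiteGauss_le (M + 1)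
  set I : ℝ := ∫ y : ℝ, ‖y ^ (M + 1) * f y‖
  intro ε hε
  have hlim : Tendsto (fun σ : ℝ => C * I / σ) atTop (𝓝 0) :=
    tendsto_const_nhds.div_atTop tendsto_id
  filter_upwards [hlim.eventually (gt_mem_nhds hε), eventually_gt_atTop 0] with σ hσε hσ w _
  refine lt_of_le_of_lt ?_ hσε
  set R : ℝ → ℝ := fun y => gauss (w - y / σ) -
    ∑ n ∈ Finset.range (M + 1), (y / σ) ^ n / n.factorial * hermiteGauss n w with hR
  have hterm : ∀ n ∈ Finset.range (M + 1), Integrable (fun y : ℝ =>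
      y ^ n * f y * ((σ ^ n)⁻¹ / n.factorial * hermiteGauss n w)) := fun n hn =>
    (hpow n (Finset.mem_range.mp hn).le).mul_const _
  have hsplit : ∀ y, f y * R y = f y * gauss (w - y / σ) - ∑ n ∈ Finset.range (M + 1),
      y ^ n * f y * ((σ ^ n)⁻¹ / n.factorial * hermiteGauss n w) := by
    intro y
    rw [hR, mul_sub, Finset.mul_sum]
    congr 1
    refine Finset.sum_congr rfl fun n _ => ?_
    rw [div_pow]
    ring
  have hrem : σ ^ (M + 1) * ((∫ y : ℝ, f y * gaussScaled σ (σ * w - y)) -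
        ∑ n ∈ Finset.range (M + 1),
          (moment1 f n / (Nat.factorial n : ℝ)) * σ ^ (-(n : ℤ) - 1) *
            hermiteR n w * gauss w) = σ ^ M * ∫ y : ℝ, f y * R y := by
    simp_rw [hsplit]
    rw [integral_sub (integrable_mul_gauss hf w σ) (integrable_finsetSum _ hterm),
      integral_finsetSum _ hterm, pow_succ, mul_assoc, mul_sub σ, ← integral_const_mul,
      Finset.mul_sum]
    congr 2
    · refine integral_congr_ae (ae_of_all _ fun y => ?_)
      simp only [gaussScaled, sub_div, mul_div_cancel_left₀ w hσ.ne']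
      field_simp
    · refine Finset.sum_congr rfl fun n _ => ?_
      rw [integral_mul_const, zpow_sub₀ hσ.ne', zpow_neg, zpow_natCast, zpow_one]
      simp only [hermiteGauss, moment1]
      field_simp
  have hbound : ∀ y, ‖f y * R y‖ ≤ C / σ ^ (M + 1) * ‖y ^ (M + 1) * f y‖ := by
    intro y
    have h := abs_sub_taylor_sum_le hasDerivAt_hermiteGauss (M + 1) 0 (by simpa using hC) w (y / σ)
    have hR' : |R y| ≤ C * |y / σ| ^ (M + 1) := by
      simpa [hermiteGauss, hermiteR, hR] using h
    rw [norm_mul, norm_mul, norm_pow, Real.norm_eq_abs, Real.norm_eq_abs, Real.norm_eq_abs]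
    refine (mul_le_mul_of_nonneg_left hR' (abs_nonneg _)).trans_eq ?_
    rw [abs_div, abs_of_pos hσ, div_pow]
    ring
  rw [hrem, abs_mul, abs_of_pos (pow_pos hσ M)]
  calc σ ^ M * |∫ y : ℝ, f y * R y|
      ≤ σ ^ M * ∫ y : ℝ, C / σ ^ (M + 1) * ‖y ^ (M + 1) * f y‖ := by
        gcongr
        exact norm_integral_le_of_norm_le ((hpow (M + 1) le_rfl).norm.const_mul _)
          (ae_of_all _ hbound)
    _ = C * I / σ := by
        rw [integral_const_mul, pow_succ]
        field_simp
        rfl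
end
end

section
/- Let f : ℝ → ℝ be integrable and of exponential order, and let F(x,t) = (f*G_{√t})(x) be the associated heat-equation solution. If F_xx(x₀, t₀) = 0 for some x₀ ∈ ℝ and t₀ > 0, then for every ε > 0 and every δ with 0 < δ < t₀, there exists a point (x,t) ∈ [x₀−ε, x₀+ε] × [t₀−δ, t₀) with F_xx(x,t) = 0. -/
open MeasureTheory Real Filter Topology

noncomputable section

/-- `f : ℝ → ℝ` is integrable and of exponential order. -/
def ExpOrder1 (f : ℝ → ℝ) : Prop :=
  Integrable f ∧ ∃ C γ : ℝ, 0 < C ∧ 0 < γ ∧ ∀ᵐ x : ℝ, |f x| ≤ C * Real.exp (-γ * |x|)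

/-- The Gaussian kernel `G_σ(x) = (2πσ²)^{-1/2} e^{-x²/(2σ²)}`. -/
def gaussK (σ x : ℝ) : ℝ := (Real.sqrt (2 * Real.pi * σ ^ 2))⁻¹ * Real.exp (-x ^ 2 / (2 * σ ^ 2))

/-- The heat-equation solution `F(x,t) = (f * G_{√t})(x)` with initial datum `f`. -/
def heatSol (f : ℝ → ℝ) (x t : ℝ) : ℝ := ∫ y, f y * gaussK (Real.sqrt t) (x - y)

/-- `F_xx`, the second partial derivative of the heat solution in `x`. -/
def heatSolXX (f : ℝ → ℝ) (x t : ℝ) : ℝ := iteratedDeriv 2 (fun x' => heatSol f x' t) x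

/-- Second-order necessary condition at a local minimum. -/
theorem nonneg_of_isLocalMin_of_hasDerivAt {g g' : ℝ → ℝ} {x c : ℝ} (hmin : IsLocalMin g x)
    (hg : ∀ᶠ y in 𝓝 x, HasDerivAt g (g' y) y) (hg' : HasDerivAt g' c x) : 0 ≤ c := by
  by_contra! hc
  have hderiv : deriv g =ᶠ[𝓝 x] g' := hg.mono fun y hy => hy.deriv
  have hderiv2 : deriv (deriv g) x = c := by rw [hderiv.deriv_eq, hg'.deriv]
  have hmax : IsLocalMax g x :=
    isLocalMax_of_deriv_deriv_neg (by rwa [hderiv2]) hmin.deriv_eq_zero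
      hg.self_of_nhds.continuousAt
  have hconst : g =ᶠ[𝓝 x] fun _ => g x := by
    filter_upwards [hmin, hmax] with y h1 h2 using le_antisymm h2 h1
  have hzero : deriv g =ᶠ[𝓝 x] fun _ => 0 := by
    simpa using hconst.deriv
  have : deriv (deriv g) x = 0 := by rw [hzero.deriv_eq]; simp
  linarith

/-- A function that is minimal at the right end of an interval has nonpositive derivative there. -/
theorem nonpos_of_hasDerivAt_of_le_left {g : ℝ → ℝ} {s t c : ℝ} (hst : s < t)
    (hle : ∀ r ∈ Set.Icc s t, g t ≤ g r) (hg : HasDerivAt g c t) : c ≤ 0 := by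
  have hlim : Tendsto (slope g t) (𝓝[<] t) (𝓝 c) :=
    hg.tendsto_slope.mono_left (nhdsWithin_mono _ fun r hr => ne_of_lt hr)
  refine le_of_tendsto hlim ?_
  filter_upwards [Ioo_mem_nhdsLT hst] with r hr
  rw [slope_def_field]
  exact div_nonpos_of_nonneg_of_nonpos (sub_nonneg.2 (hle r ⟨hr.1.le, hr.2.le⟩))
    (sub_nonpos.2 hr.2.le)

/-- Weak minimum principle for the heat equation `w_t = ½ w_xx` on a rectangle. -/
theorem heat_weak_min_principle {w wx wxx : ℝ → ℝ → ℝ} {a b s T : ℝ}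
    (hcont : ContinuousOn (Function.uncurry w) (Set.Icc a b ×ˢ Set.Icc s T))
    (hwx : ∀ x ∈ Set.Ioo a b, ∀ t ∈ Set.Ioc s T, HasDerivAt (fun y => w y t) (wx x t) x)
    (hwxx : ∀ x ∈ Set.Ioo a b, ∀ t ∈ Set.Ioc s T, HasDerivAt (fun y => wx y t) (wxx x t) x)
    (hwt : ∀ x ∈ Set.Ioo a b, ∀ t ∈ Set.Ioc s T, HasDerivAt (fun r => w x r) (wxx x t / 2) t)
    (hinit : ∀ x ∈ Set.Icc a b, 0 ≤ w x s)
    (hleft : ∀ t ∈ Set.Icc s T, 0 ≤ w a t) (hright : ∀ t ∈ Set.Icc s T, 0 ≤ w b t) :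
    ∀ x ∈ Set.Icc a b, ∀ t ∈ Set.Icc s T, 0 ≤ w x t := by
  intro x hx t ht
  by_contra! hneg
  have hst : s < t := ht.1.lt_of_ne fun h => by
    subst h
    exact (hinit x hx).not_gt hneg
  set κ : ℝ := -w x t / (2 * (t - s)) with hκ
  have hκpos : 0 < κ := div_pos (neg_pos.2 hneg) (by linarith)
  have hz : w x t + κ * (t - s) < 0 := by
    have : κ * (t - s) = -w x t / 2 := by
      rw [hκ]
      have : t - s ≠ 0 := by linarith
      field_simp
    linarith
  obtain ⟨⟨y, r⟩, ⟨hy, hr⟩, hmin⟩ :=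
    (isCompact_Icc.prod isCompact_Icc).exists_isMinOn (s := Set.Icc a b ×ˢ Set.Icc s T)
      (f := fun p : ℝ × ℝ => w p.1 p.2 + κ * (p.2 - s)) ⟨(x, t), hx, ht⟩
      (hcont.add (by fun_prop))
  have hle : ∀ x' ∈ Set.Icc a b, ∀ t' ∈ Set.Icc s T,
      w y r + κ * (r - s) ≤ w x' t' + κ * (t' - s) :=
    fun x' hx' t' ht' => hmin (Set.mk_mem_prod hx' ht')
  simp only at hy hr
  have hwneg : w y r < 0 := by
    have := hle x hx t ht
    have := mul_nonneg hκpos.le (sub_nonneg.2 hr.1)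
    linarith
  have hsr : s < r := hr.1.lt_of_ne fun h => by
    subst h
    exact (hinit y hy).not_gt hwneg
  have hay : a < y := hy.1.lt_of_ne fun h => by
    subst h
    exact (hleft r hr).not_gt hwneg
  have hyb : y < b := hy.2.lt_of_ne fun h => by
    subst h
    exact (hright r hr).not_gt hwneg
  have hyI : y ∈ Set.Ioo a b := ⟨hay, hyb⟩
  have hrI : r ∈ Set.Ioc s T := ⟨hsr, hr.2⟩
  have hspace : 0 ≤ wxx y r := by
    refine nonneg_of_isLocalMin_of_hasDerivAt (g := fun x' => w x' r) ?_ ?_ (hwxx y hyI r hrI)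
    · filter_upwards [Ioo_mem_nhds hay hyb] with x' hx'
      have := hle x' (Set.Ioo_subset_Icc_self hx') r hr
      linarith
    · filter_upwards [Ioo_mem_nhds hay hyb] with x' hx' using hwx x' hx' r hrI
  have htime : wxx y r / 2 + κ ≤ 0 := by
    refine nonpos_of_hasDerivAt_of_le_left (g := fun t' => w y t' + κ * (t' - s)) hsr
      (fun t' ht' => hle y hy t' ⟨ht'.1, ht'.2.trans hr.2⟩) ?_
    simpa using (hwt y hyI r hrI).fun_add (((hasDerivAt_id r).sub_const s).const_mul κ)
  linarith

/-- A solution of the heat equation that is positive before time `T` on a rectangle is positive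
at time `T` at the center. -/
theorem heat_pos_of_pos_before {u ux uxx : ℝ → ℝ → ℝ} {x₀ ε s T : ℝ} (hε : 0 < ε) (hsT : s < T)
    (hcont : ContinuousOn (Function.uncurry u) (Set.Icc (x₀ - ε) (x₀ + ε) ×ˢ Set.Icc s T))
    (hux : ∀ x, ∀ t ∈ Set.Ioc s T, HasDerivAt (fun y => u y t) (ux x t) x)
    (huxx : ∀ x, ∀ t ∈ Set.Ioc s T, HasDerivAt (fun y => ux y t) (uxx x t) x)
    (hut : ∀ x, ∀ t ∈ Set.Ioc s T, HasDerivAt (fun r => u x r) (uxx x t / 2) t)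
    (hpos : ∀ x ∈ Set.Icc (x₀ - ε) (x₀ + ε), ∀ t ∈ Set.Ico s T, 0 < u x t) :
    0 < u x₀ T := by
  have hx₀ : x₀ ∈ Set.Icc (x₀ - ε) (x₀ + ε) := ⟨by linarith, by linarith⟩
  have hnonneg : ∀ x ∈ Set.Icc (x₀ - ε) (x₀ + ε), ∀ t ∈ Set.Icc s T, 0 ≤ u x t := by
    intro x hx t ht
    rcases ht.2.lt_or_eq with h | rfl
    · exact (hpos x hx t ⟨ht.1, h⟩).le
    · have hlim : Tendsto (u x) (𝓝[<] t) (𝓝 (u x t)) :=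
        ((hut x t ⟨hsT, le_rfl⟩).continuousAt.tendsto).mono_left nhdsWithin_le_nhds
      refine ge_of_tendsto hlim ?_
      filter_upwards [Ioo_mem_nhdsLT hsT] with r hr using (hpos x hx r ⟨hr.1.le, hr.2⟩).le
  obtain ⟨z, hz, hzmin⟩ := isCompact_Icc.exists_isMinOn (f := fun x => u x s) ⟨x₀, hx₀⟩
    (hcont.comp (f := fun x => (x, s)) (by fun_prop) fun x hx => ⟨hx, le_rfl, hsT.le⟩)
  set η := u z s with hη
  have hηpos : 0 < η := hpos z hz s ⟨le_rfl, hsT⟩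
  set k : ℝ := π / (2 * ε) with hk
  have hkε : k * ε = π / 2 := by rw [hk]; field_simp
  have hE : ∀ t, HasDerivAt (fun r => Real.exp (-(k ^ 2 / 2) * (r - s)))
      (Real.exp (-(k ^ 2 / 2) * (t - s)) * -(k ^ 2 / 2)) t := fun t => by
    simpa using (((hasDerivAt_id t).sub_const s).const_mul (-(k ^ 2 / 2))).exp
  have hlin : ∀ x, HasDerivAt (fun y => k * (y - x₀)) k x := fun x => by
    simpa using ((hasDerivAt_id x).sub_const x₀).const_mul k
  have hbarrier := heat_weak_min_principle
    (w := fun x t => u x t - η * (Real.cos (k * (x - x₀)) * Real.exp (-(k ^ 2 / 2) * (t - s))))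
    (wx := fun x t =>
      ux x t - η * (-Real.sin (k * (x - x₀)) * k * Real.exp (-(k ^ 2 / 2) * (t - s))))
    (wxx := fun x t =>
      uxx x t - η * (-(Real.cos (k * (x - x₀)) * k) * k * Real.exp (-(k ^ 2 / 2) * (t - s))))
    (a := x₀ - ε) (b := x₀ + ε) (s := s) (T := T)
    (hcont.sub (by fun_prop))
    (fun x _ t ht => (hux x t ht).sub (((hlin x).cos.mul_const _).const_mul η))
    (fun x _ t ht => (huxx x t ht).sub
      ((((hlin x).sin.neg.mul_const k).mul_const _).const_mul η))
    (fun x _ t ht => ((hut x t ht).sub (((hE t).const_mul _).const_mul η)).congr_deriv (by ring))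
    (fun x hx => by
      have h1 : η ≤ u x s := hzmin hx
      have h2 := mul_le_mul_of_nonneg_left (Real.cos_le_one (k * (x - x₀))) hηpos.le
      simp only [sub_self, mul_zero, Real.exp_zero, mul_one] at h2 ⊢
      linarith)
    (fun t ht => by
      have h : k * (x₀ - ε - x₀) = -(π / 2) := by rw [← hkε]; ring
      simpa only [h, Real.cos_neg, Real.cos_pi_div_two, zero_mul, mul_zero, sub_zero] using
        hnonneg (x₀ - ε) ⟨le_rfl, by linarith⟩ t ht)
    (fun t ht => by
      have h : k * (x₀ + ε - x₀) = π / 2 := by rw [← hkε]; ring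
      simpa only [h, Real.cos_pi_div_two, zero_mul, mul_zero, sub_zero] using
        hnonneg (x₀ + ε) ⟨by linarith, le_rfl⟩ t ht)
    x₀ hx₀ T ⟨hsT.le, le_rfl⟩
  simp only [sub_self, mul_zero, Real.cos_zero, one_mul] at hbarrier
  have := mul_pos hηpos (Real.exp_pos (-(k ^ 2 / 2) * (T - s)))
  linarith

/-- A solution of the heat equation without zeros before time `T` on a rectangle does not vanish
at time `T` at the center. -/
theorem heat_ne_zero_of_ne_zero_before {u ux uxx : ℝ → ℝ → ℝ} {x₀ ε s T : ℝ} (hε : 0 < ε)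
    (hsT : s < T)
    (hcont : ContinuousOn (Function.uncurry u) (Set.Icc (x₀ - ε) (x₀ + ε) ×ˢ Set.Icc s T))
    (hux : ∀ x, ∀ t ∈ Set.Ioc s T, HasDerivAt (fun y => u y t) (ux x t) x)
    (huxx : ∀ x, ∀ t ∈ Set.Ioc s T, HasDerivAt (fun y => ux y t) (uxx x t) x)
    (hut : ∀ x, ∀ t ∈ Set.Ioc s T, HasDerivAt (fun r => u x r) (uxx x t / 2) t)
    (hne : ∀ x ∈ Set.Icc (x₀ - ε) (x₀ + ε), ∀ t ∈ Set.Ico s T, u x t ≠ 0) :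
    u x₀ T ≠ 0 := by
  have hconn : IsPreconnected (Set.Icc (x₀ - ε) (x₀ + ε) ×ˢ Set.Ico s T) :=
    isPreconnected_Icc.prod isPreconnected_Ico
  have hcont' := hcont.mono (Set.prod_mono subset_rfl Set.Ico_subset_Icc_self)
  have hsign : (∀ x ∈ Set.Icc (x₀ - ε) (x₀ + ε), ∀ t ∈ Set.Ico s T, 0 < u x t) ∨
      ∀ x ∈ Set.Icc (x₀ - ε) (x₀ + ε), ∀ t ∈ Set.Ico s T, u x t < 0 := by
    by_contra! h
    obtain ⟨⟨x, hx, t, ht, hxt⟩, ⟨y, hy, r, hr, hyr⟩⟩ := h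
    obtain ⟨p, hp, hp0⟩ := hconn.intermediate_value (Set.mk_mem_prod hx ht)
      (Set.mk_mem_prod hy hr) hcont' ⟨hxt, hyr⟩
    exact hne p.1 hp.1 p.2 hp.2 hp0
  rcases hsign with h | h
  · exact (heat_pos_of_pos_before hε hsT hcont hux huxx hut h).ne'
  · have := heat_pos_of_pos_before (u := fun x t => -u x t) (ux := fun x t => -ux x t)
      (uxx := fun x t => -uxx x t) hε hsT hcont.neg (fun x t ht => (hux x t ht).neg)
      (fun x t ht => (huxx x t ht).neg)
      (fun x t ht => (hut x t ht).neg.congr_deriv (by ring))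
      (fun x hx t ht => neg_pos.2 (h x hx t ht))
    exact (neg_pos.1 this).ne

/-- The moments `∫ f(y) (x-y)ⁿ e^{-(x-y)²/(2t)} dy` of `f` against a Gaussian. -/
def gaussMoment (f : ℝ → ℝ) (n : ℕ) (x t : ℝ) : ℝ :=
  ∫ y, f y * ((x - y) ^ n * Real.exp (-(x - y) ^ 2 / (2 * t)))

/-- A bound for `|z|ⁿ e^{-z²/(2t)}` valid for all `z` and all `t ≤ b`. -/
theorem abs_pow_mul_exp_le (n : ℕ) {t b : ℝ} (ht : 0 < t) (htb : t ≤ b) (z : ℝ) :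
    |z ^ n * Real.exp (-z ^ 2 / (2 * t))| ≤ 1 + n.factorial * (2 * b) ^ n := by
  have hb : 0 < b := ht.trans_le htb
  have hmono : Real.exp (-z ^ 2 / (2 * t)) ≤ Real.exp (-(z ^ 2 / (2 * b))) := by
    rw [neg_div]
    gcongr
  have hpow : |z ^ n| ≤ 1 + (z ^ 2) ^ n := by
    have : (z ^ 2) ^ n = |z ^ n| ^ 2 := by rw [sq_abs]; ring
    rw [this]
    nlinarith [sq_nonneg (|z ^ n| - 1), abs_nonneg (z ^ n)]
  have hfac : (z ^ 2) ^ n ≤ n.factorial * (2 * b) ^ n * Real.exp (z ^ 2 / (2 * b)) := by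
    have h := Real.pow_div_factorial_le_exp (z ^ 2 / (2 * b)) (by positivity) n
    rw [div_pow, div_div, div_le_iff₀ (by positivity)] at h
    linarith
  have hexp1 : Real.exp (-(z ^ 2 / (2 * b))) ≤ 1 := by
    rw [Real.exp_le_one_iff, neg_nonpos]
    positivity
  have hmul : Real.exp (z ^ 2 / (2 * b)) * Real.exp (-(z ^ 2 / (2 * b))) = 1 := by
    rw [← Real.exp_add]; simp
  rw [abs_mul, Real.abs_exp]
  calc |z ^ n| * Real.exp (-z ^ 2 / (2 * t))
      ≤ (1 + n.factorial * (2 * b) ^ n * Real.exp (z ^ 2 / (2 * b))) *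
          Real.exp (-(z ^ 2 / (2 * b))) := by
        gcongr
        linarith
    _ = Real.exp (-(z ^ 2 / (2 * b))) + n.factorial * (2 * b) ^ n *
          (Real.exp (z ^ 2 / (2 * b)) * Real.exp (-(z ^ 2 / (2 * b)))) := by ring
    _ ≤ 1 + n.factorial * (2 * b) ^ n := by rw [hmul]; linarith

theorem aestronglyMeasurable_gaussMoment_integrand {f : ℝ → ℝ} (hf : Integrable f) (n : ℕ)
    (x t : ℝ) :
    AEStronglyMeasurable
      (fun y => f y * ((x - y) ^ n * Real.exp (-(x - y) ^ 2 / (2 * t)))) volume :=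
  hf.aestronglyMeasurable.mul (Continuous.aestronglyMeasurable (by fun_prop))

theorem integrable_gaussMoment_integrand {f : ℝ → ℝ} (hf : Integrable f) (n : ℕ) (x : ℝ) {t : ℝ}
    (ht : 0 < t) :
    Integrable fun y => f y * ((x - y) ^ n * Real.exp (-(x - y) ^ 2 / (2 * t))) :=
  hf.mul_bdd (c := 1 + n.factorial * (2 * t) ^ n) (Continuous.aestronglyMeasurable (by fun_prop))
    (ae_of_all _ fun y => abs_pow_mul_exp_le n ht le_rfl (x - y))

theorem continuousOn_gaussMoment {f : ℝ → ℝ} (hf : Integrable f) (n : ℕ) :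
    ContinuousOn (Function.uncurry (gaussMoment f n)) {p | 0 < p.2} := by
  rintro ⟨x, t⟩ ht
  change 0 < t at ht
  refine ContinuousAt.continuousWithinAt ?_
  have hnear : ∀ᶠ p : ℝ × ℝ in 𝓝 (x, t), p.2 ∈ Set.Ioo 0 (2 * t) :=
    continuousAt_snd.eventually_mem (Ioo_mem_nhds ht (by linarith))
  refine continuousAt_of_dominated
    (F := fun (p : ℝ × ℝ) y => f y * ((p.1 - y) ^ n * Real.exp (-(p.1 - y) ^ 2 / (2 * p.2))))
    (bound := fun y => |f y| * (1 + n.factorial * (2 * (2 * t)) ^ n)) ?_ ?_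
    (hf.abs.mul_const _) ?_
  · exact Eventually.of_forall fun p => aestronglyMeasurable_gaussMoment_integrand hf n p.1 p.2
  · filter_upwards [hnear] with p hp
    refine ae_of_all _ fun y => ?_
    rw [Real.norm_eq_abs, abs_mul]
    exact mul_le_mul_of_nonneg_left (abs_pow_mul_exp_le n hp.1 hp.2.le _) (abs_nonneg _)
  · refine ae_of_all _ fun y => ?_
    have : 2 * (x, t).2 ≠ 0 := by simpa using ht.ne'
    fun_prop (disch := assumption)

theorem hasDerivAt_gaussMoment_space {f : ℝ → ℝ} (hf : Integrable f) (n : ℕ) (x : ℝ) {t : ℝ}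
    (ht : 0 < t) :
    HasDerivAt (fun x => gaussMoment f n x t)
      (n * gaussMoment f (n - 1) x t - gaussMoment f (n + 1) x t / t) x := by
  have hint := integrable_gaussMoment_integrand hf (t := t)
  have key := hasDerivAt_integral_of_dominated_loc_of_deriv_le (μ := volume) (x₀ := x)
    (s := Set.univ)
    (F := fun x y => f y * ((x - y) ^ n * Real.exp (-(x - y) ^ 2 / (2 * t))))
    (F' := fun x y => n * (f y * ((x - y) ^ (n - 1) * Real.exp (-(x - y) ^ 2 / (2 * t)))) -
      f y * ((x - y) ^ (n + 1) * Real.exp (-(x - y) ^ 2 / (2 * t))) / t)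
    (bound := fun y => n * (|f y| * (1 + (n - 1).factorial * (2 * t) ^ (n - 1))) +
      |f y| * (1 + (n + 1).factorial * (2 * t) ^ (n + 1)) / t)
    univ_mem
    (Eventually.of_forall fun x => aestronglyMeasurable_gaussMoment_integrand hf n x t)
    (hint n x ht)
    (((hint (n - 1) x ht).const_mul _).sub ((hint (n + 1) x ht).div_const _)).aestronglyMeasurable
    (ae_of_all _ fun y x _ => by
      refine (norm_sub_le _ _).trans (add_le_add ?_ ?_)
      · rw [norm_mul, Real.norm_natCast, Real.norm_eq_abs, abs_mul]
        gcongr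
        exact abs_pow_mul_exp_le _ ht le_rfl _
      · rw [norm_div, Real.norm_of_nonneg ht.le, Real.norm_eq_abs, abs_mul]
        gcongr
        exact abs_pow_mul_exp_le _ ht le_rfl _)
    (((hf.abs.mul_const _).const_mul _).add ((hf.abs.mul_const _).div_const _))
    (ae_of_all _ fun y x _ => by
      have hsub : HasDerivAt (fun x => x - y) 1 x := (hasDerivAt_id x).sub_const y
      have h := (((hsub.pow n).mul ((hsub.pow 2).neg.div_const (2 * t)).exp).const_mul (f y))
      refine h.congr_deriv ?_
      have := ht.ne'
      simp only [Pi.pow_apply, Pi.neg_apply]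
      field_simp
      push_cast
      ring)
  refine key.2.congr_deriv ?_
  rw [integral_sub ((hint (n - 1) x ht).const_mul _) ((hint (n + 1) x ht).div_const _),
    integral_const_mul, integral_div]
  rfl

theorem hasDerivAt_gaussMoment_time {f : ℝ → ℝ} (hf : Integrable f) (n : ℕ) (x : ℝ) {t : ℝ}
    (ht : 0 < t) :
    HasDerivAt (gaussMoment f n x) (gaussMoment f (n + 2) x t / (2 * t ^ 2)) t := by
  have key := hasDerivAt_integral_of_dominated_loc_of_deriv_le (μ := volume) (x₀ := t)
    (s := Set.Ioo (t / 2) (2 * t))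
    (F := fun t y => f y * ((x - y) ^ n * Real.exp (-(x - y) ^ 2 / (2 * t))))
    (F' := fun t y => f y * ((x - y) ^ (n + 2) * Real.exp (-(x - y) ^ 2 / (2 * t))) / (2 * t ^ 2))
    (bound := fun y =>
      |f y| * (1 + (n + 2).factorial * (2 * (2 * t)) ^ (n + 2)) / (2 * (t / 2) ^ 2))
    (Ioo_mem_nhds (by linarith) (by linarith))
    (Eventually.of_forall fun t => aestronglyMeasurable_gaussMoment_integrand hf n x t)
    (integrable_gaussMoment_integrand hf n x ht)
    ((integrable_gaussMoment_integrand hf (n + 2) x ht).div_const _).aestronglyMeasurable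
    (ae_of_all _ fun y r hr => by
      have hr0 : 0 < r := by linarith [hr.1]
      rw [norm_div, Real.norm_of_nonneg (by positivity : 0 ≤ 2 * r ^ 2), Real.norm_eq_abs, abs_mul]
      gcongr
      · exact abs_pow_mul_exp_le _ hr0 hr.2.le _
      · exact hr.1.le)
    ((hf.abs.mul_const _).div_const _)
    (ae_of_all _ fun y r hr => by
      have hr0 : r ≠ 0 := by linarith [hr.1]
      have h := ((((((hasDerivAt_id r).const_mul 2).fun_inv (by simpa using hr0)).const_mul
        (-(x - y) ^ 2)).exp.const_mul ((x - y) ^ n)).const_mul (f y))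
      simp only [← div_eq_mul_inv, id_eq] at h
      refine h.congr_deriv ?_
      field_simp
      ring)
  refine key.2.congr_deriv ?_
  rw [integral_div]
  rfl

theorem heatSol_eq_gaussMoment (f : ℝ → ℝ) (x : ℝ) {t : ℝ} (ht : 0 < t) :
    heatSol f x t = (Real.sqrt (2 * π * t))⁻¹ * gaussMoment f 0 x t := by
  rw [heatSol, gaussMoment, ← integral_const_mul]
  congr 1 with y
  rw [gaussK, Real.sq_sqrt ht.le]
  ring

/-- `F_xx` written through Gaussian moments of `f`. -/
def gaussXX (f : ℝ → ℝ) (x t : ℝ) : ℝ :=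
  (Real.sqrt (2 * π * t))⁻¹ * (gaussMoment f 2 x t / t ^ 2 - gaussMoment f 0 x t / t)

theorem heatSolXX_eq_gaussXX {f : ℝ → ℝ} (hf : Integrable f) (x : ℝ) {t : ℝ} (ht : 0 < t) :
    heatSolXX f x t = gaussXX f x t := by
  have h0 : deriv (fun y => heatSol f y t) =
      fun y => (Real.sqrt (2 * π * t))⁻¹ * -(gaussMoment f 1 y t / t) := by
    ext y
    simp only [heatSol_eq_gaussMoment f _ ht]
    simpa using ((hasDerivAt_gaussMoment_space hf 0 y ht).const_mul _).deriv
  rw [heatSolXX, gaussXX, iteratedDeriv_succ, iteratedDeriv_one, h0]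
  rw [((((hasDerivAt_gaussMoment_space hf 1 x ht).div_const t).fun_neg).const_mul _).deriv]
  have := ht.ne'
  norm_num
  field_simp
  ring

theorem continuousOn_gaussXX {f : ℝ → ℝ} (hf : Integrable f) :
    ContinuousOn (Function.uncurry (gaussXX f)) {p | 0 < p.2} := by
  have hne : ∀ p ∈ {p : ℝ × ℝ | 0 < p.2}, p.2 ≠ 0 := fun p hp => ne_of_gt hp
  refine ContinuousOn.mul (ContinuousOn.inv₀ (by fun_prop) fun p hp => ?_) ?_
  · have : 0 < p.2 := hp
    positivity
  · exact ((continuousOn_gaussMoment hf 2).div (by fun_prop) fun p hp => pow_ne_zero 2 (hne p hp)).sub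
      ((continuousOn_gaussMoment hf 0).div (by fun_prop) hne)

theorem hasDerivAt_gaussXX_space {f : ℝ → ℝ} (hf : Integrable f) (x : ℝ) {t : ℝ} (ht : 0 < t) :
    HasDerivAt (fun y => gaussXX f y t)
      ((Real.sqrt (2 * π * t))⁻¹ *
        (3 * gaussMoment f 1 x t / t ^ 2 - gaussMoment f 3 x t / t ^ 3)) x := by
  refine ((((hasDerivAt_gaussMoment_space hf 2 x ht).div_const (t ^ 2)).fun_sub
    ((hasDerivAt_gaussMoment_space hf 0 x ht).div_const t)).const_mul
      (Real.sqrt (2 * π * t))⁻¹).congr_deriv ?_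
  have := ht.ne'
  norm_num
  left
  field_simp
  ring

theorem hasDerivAt_gaussXXX_space {f : ℝ → ℝ} (hf : Integrable f) (x : ℝ) {t : ℝ} (ht : 0 < t) :
    HasDerivAt (fun y => (Real.sqrt (2 * π * t))⁻¹ *
        (3 * gaussMoment f 1 y t / t ^ 2 - gaussMoment f 3 y t / t ^ 3))
      ((Real.sqrt (2 * π * t))⁻¹ * (3 * gaussMoment f 0 x t / t ^ 2 -
        6 * gaussMoment f 2 x t / t ^ 3 + gaussMoment f 4 x t / t ^ 4)) x := by
  refine (((((hasDerivAt_gaussMoment_space hf 1 x ht).const_mul 3).div_const (t ^ 2)).fun_sub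
    ((hasDerivAt_gaussMoment_space hf 3 x ht).div_const (t ^ 3))).const_mul
      (Real.sqrt (2 * π * t))⁻¹).congr_deriv ?_
  have := ht.ne'
  norm_num
  left
  field_simp
  ring

theorem hasDerivAt_inv_sqrt_two_pi_mul {t : ℝ} (ht : 0 < t) :
    HasDerivAt (fun r => (Real.sqrt (2 * π * r))⁻¹) (-(Real.sqrt (2 * π * t))⁻¹ / (2 * t)) t := by
  have hpos : 0 < 2 * π * t := by positivity
  have hlin : HasDerivAt (fun r => 2 * π * r) (2 * π) t := by
    simpa using (hasDerivAt_id t).const_mul (2 * π)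
  refine ((hlin.sqrt hpos.ne').fun_inv (Real.sqrt_ne_zero'.2 hpos)).congr_deriv ?_
  have hs : 0 < Real.sqrt (2 * π * t) := Real.sqrt_pos.2 hpos
  rw [Real.sq_sqrt hpos.le]
  field_simp

theorem hasDerivAt_gaussXX_time {f : ℝ → ℝ} (hf : Integrable f) (x : ℝ) {t : ℝ} (ht : 0 < t) :
    HasDerivAt (fun r => gaussXX f x r)
      ((Real.sqrt (2 * π * t))⁻¹ * (3 * gaussMoment f 0 x t / t ^ 2 -
        6 * gaussMoment f 2 x t / t ^ 3 + gaussMoment f 4 x t / t ^ 4) / 2) t := by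
  have hne := ht.ne'
  refine ((hasDerivAt_inv_sqrt_two_pi_mul ht).fun_mul
    (((hasDerivAt_gaussMoment_time hf 2 x ht).fun_div (hasDerivAt_pow 2 t) (by positivity)).fun_sub
      ((hasDerivAt_gaussMoment_time hf 0 x ht).fun_div (hasDerivAt_id' t) hne))).congr_deriv ?_
  norm_num
  field_simp
  ring

/-- **Zeros of `F_xx` do not appear spontaneously** (Lemma 7): if `F_xx(x₀,t₀) = 0` then
every rectangle `[x₀-ε, x₀+ε] × [t₀-δ, t₀)` contains a zero of `F_xx`. -/
theorem zero_in_every_earlier_rectangle (f : ℝ → ℝ) (hf : ExpOrder1 f)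
    (x₀ t₀ : ℝ) (ht₀ : 0 < t₀) (hzero : heatSolXX f x₀ t₀ = 0) :
    ∀ ε > (0 : ℝ), ∀ δ : ℝ, 0 < δ → δ < t₀ →
      ∃ x t : ℝ, x ∈ Set.Icc (x₀ - ε) (x₀ + ε) ∧ t ∈ Set.Ico (t₀ - δ) t₀ ∧
        heatSolXX f x t = 0 := by
  intro ε hε δ hδ hδt
  by_contra! hne
  have hf := hf.1
  have hpos : ∀ {t}, t ∈ Set.Icc (t₀ - δ) t₀ → 0 < t := fun ht => by linarith [ht.1]
  refine heat_ne_zero_of_ne_zero_before (u := gaussXX f) (T := t₀) (s := t₀ - δ) hε (by linarith)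
    ((continuousOn_gaussXX hf).mono fun p hp => hpos hp.2)
    (fun x t ht => hasDerivAt_gaussXX_space hf x (hpos (Set.Ioc_subset_Icc_self ht)))
    (fun x t ht => hasDerivAt_gaussXXX_space hf x (hpos (Set.Ioc_subset_Icc_self ht)))
    (fun x t ht => hasDerivAt_gaussXX_time hf x (hpos (Set.Ioc_subset_Icc_self ht)))
    (fun x hx t ht => ?_) ((heatSolXX_eq_gaussXX hf x₀ ht₀).symm.trans hzero)
  rw [← heatSolXX_eq_gaussXX hf x (hpos (Set.Ico_subset_Icc_self ht))]
  exact hne x t hx ht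
end
end

section
/- Let h̃ : ℝ → ℝ be integrable, nonnegative almost everywhere, and symmetric about 0 (h̃(−x) = h̃(x) for a.e. x), with a₀ = ∫ h̃(x) dx > 0. For σ > 0 define Q(x,σ) = −a₀ G_σ(x) + (h̃ * G_σ)(x). Then for each σ > 0 the function x ↦ Q(x,σ) has exactly two zeros: there exist real numbers x₁ < x₂ with Q(x₁,σ) = Q(x₂,σ) = 0, Q(x,σ) < 0 for all x ∈ (x₁, x₂), and Q(x,σ) > 0 for all x < x₁ and all x > x₂. -/
open MeasureTheory Real Filter Topology

noncomputable section

/-- `Q(x,σ) = -a₀ G_σ(x) + (h̃ * G_σ)(x)`. -/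
def Qfun (h : ℝ → ℝ) (x σ : ℝ) : ℝ :=
  -(∫ y : ℝ, h y) * gaussK σ x + ∫ y : ℝ, h y * gaussK σ (x - y)

/-- The quotient `G_σ(x - y) / G_σ(x)`, symmetrized in `y`. -/
def coshKernel (σ x y : ℝ) : ℝ := Real.exp (-y ^ 2 / (2 * σ ^ 2)) * Real.cosh (x * y / σ ^ 2)

lemma gaussK_pos {σ : ℝ} (hσ : 0 < σ) (x : ℝ) : 0 < gaussK σ x := by
  unfold gaussK; positivity

lemma gaussK_le (σ x : ℝ) : gaussK σ x ≤ (Real.sqrt (2 * Real.pi * σ ^ 2))⁻¹ := by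
  refine mul_le_of_le_one_right (by positivity) (Real.exp_le_one_iff.2 ?_)
  rw [neg_div]
  exact neg_nonpos.2 (by positivity)

lemma norm_gaussK_le (σ x : ℝ) : ‖gaussK σ x‖ ≤ (Real.sqrt (2 * Real.pi * σ ^ 2))⁻¹ := by
  rw [Real.norm_of_nonneg (by unfold gaussK; positivity)]
  exact gaussK_le σ x

lemma continuous_gaussK (σ : ℝ) : Continuous (gaussK σ) := by
  unfold gaussK; fun_prop

lemma gaussK_add_gaussK {σ : ℝ} (hσ : 0 < σ) (x y : ℝ) :
    gaussK σ (x - y) + gaussK σ (x + y) = 2 * gaussK σ x * coshKernel σ x y := by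
  have h1 : -(x - y) ^ 2 / (2 * σ ^ 2)
      = -x ^ 2 / (2 * σ ^ 2) + -y ^ 2 / (2 * σ ^ 2) + x * y / σ ^ 2 := by
    field_simp; ring
  have h2 : -(x + y) ^ 2 / (2 * σ ^ 2)
      = -x ^ 2 / (2 * σ ^ 2) + -y ^ 2 / (2 * σ ^ 2) + -(x * y / σ ^ 2) := by
    field_simp; ring
  simp only [gaussK, coshKernel, h1, h2, Real.exp_add, Real.cosh_eq]
  ring

lemma coshKernel_lt_coshKernel {σ x x' y : ℝ} (hσ : 0 < σ) (hy : y ≠ 0) (hx : |x| < |x'|) :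
    coshKernel σ x y < coshKernel σ x' y := by
  refine mul_lt_mul_of_pos_left (Real.cosh_lt_cosh.2 ?_) (Real.exp_pos _)
  rw [abs_div, abs_div, abs_mul, abs_mul]
  have := abs_pos.2 hy
  have : 0 < |σ ^ 2| := abs_pos.2 (by positivity)
  gcongr

lemma coshKernel_zero_lt_one {σ y : ℝ} (hσ : 0 < σ) (hy : y ≠ 0) : coshKernel σ 0 y < 1 := by
  have : 0 < y ^ 2 / (2 * σ ^ 2) := by positivity
  simpa [coshKernel, neg_div] using this

lemma two_mul_coshKernel_le (σ x y : ℝ) :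
    2 * coshKernel σ x y ≤ coshKernel σ (2 * x) y + coshKernel σ 0 y := by
  have h1 := Real.one_le_cosh (x * y / σ ^ 2)
  have h2 : 2 * x * y / σ ^ 2 = 2 * (x * y / σ ^ 2) := by ring
  have h3 := Real.exp_pos (-y ^ 2 / (2 * σ ^ 2))
  simp only [coshKernel, h2, Real.cosh_two_mul, Real.sinh_sq, zero_mul, zero_div, Real.cosh_zero]
  nlinarith [mul_nonneg h3.le (mul_nonneg (sub_nonneg.2 h1) (zero_le_one.trans h1))]

/-- Integration against a nonnegative density of positive mass is strictly monotone. -/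
lemma integral_mul_lt_integral_mul {α : Type*} [MeasurableSpace α] {μ : Measure α}
    {h f g : α → ℝ} (hnonneg : ∀ᵐ x ∂μ, 0 ≤ h x) (hpos : 0 < ∫ x, h x ∂μ)
    (hf : Integrable (fun x => h x * f x) μ) (hg : Integrable (fun x => h x * g x) μ)
    (hfg : ∀ᵐ x ∂μ, f x < g x) : ∫ x, h x * f x ∂μ < ∫ x, h x * g x ∂μ := by
  have hnn : 0 ≤ᵐ[μ] fun x => h x * g x - h x * f x := by
    filter_upwards [hnonneg, hfg] with x h1 h2
    exact sub_nonneg.2 (mul_le_mul_of_nonneg_left h2.le h1)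
  rw [← sub_pos, ← integral_sub hg hf]
  refine (integral_nonneg_of_ae hnn).lt_of_ne' fun h0 => hpos.ne' ?_
  refine integral_eq_zero_of_ae ?_
  filter_upwards [(integral_eq_zero_iff_of_nonneg_ae hnn (hg.sub hf)).1 h0, hfg] with x h1 h2
  have h3 : h x * (g x - f x) = 0 := by rw [mul_sub]; exact h1
  exact (mul_eq_zero.1 h3).resolve_right (sub_pos.2 h2).ne'

lemma integrable_mul_gaussK {h : ℝ → ℝ} (hint : Integrable h) (σ : ℝ) {u : ℝ → ℝ}
    (hu : Continuous u) : Integrable fun y => h y * gaussK σ (u y) :=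
  hint.mul_bdd ((continuous_gaussK σ).comp hu).aestronglyMeasurable
    (Eventually.of_forall fun y => norm_gaussK_le σ (u y))

lemma integrable_mul_coshKernel {h : ℝ → ℝ} (hint : Integrable h) {σ : ℝ} (hσ : 0 < σ) (x : ℝ) :
    Integrable fun y => h y * coshKernel σ x y := by
  have hsum := ((integrable_mul_gaussK hint σ (u := fun y => x - y) (by fun_prop)).add
    (integrable_mul_gaussK hint σ (u := fun y => x + y) (by fun_prop))).const_mul
      (2 * gaussK σ x)⁻¹
  refine hsum.congr (Eventually.of_forall fun y => ?_)
  have := (gaussK_pos hσ x).ne'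
  simp only [Pi.add_apply, ← mul_add, gaussK_add_gaussK hσ]
  field_simp

lemma continuous_Qfun {h : ℝ → ℝ} (hint : Integrable h) (σ : ℝ) :
    Continuous fun x => Qfun h x σ := by
  have hK := continuous_gaussK σ
  refine (continuous_const.mul hK).add (continuous_of_dominated
    (bound := fun y => ‖h y‖ * (Real.sqrt (2 * Real.pi * σ ^ 2))⁻¹) (fun x => ?_) (fun x => ?_)
    (hint.norm.mul_const _) ?_)
  · exact (integrable_mul_gaussK hint σ (by fun_prop)).aestronglyMeasurable
  · refine Eventually.of_forall fun y => ?_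
    rw [norm_mul]
    exact mul_le_mul_of_nonneg_left (norm_gaussK_le _ _) (norm_nonneg _)
  · exact Eventually.of_forall fun y => by fun_prop

/-- For symmetric `h`, `Q(x,σ) = G_σ(x) (∫ h(y) e^{-y²/(2σ²)} cosh(xy/σ²) dy - a₀)`. -/
lemma Qfun_eq_gaussK_mul {h : ℝ → ℝ} (hint : Integrable h) (hsymm : ∀ᵐ x : ℝ, h (-x) = h x)
    {σ : ℝ} (hσ : 0 < σ) (x : ℝ) :
    Qfun h x σ = gaussK σ x * ((∫ y, h y * coshKernel σ x y) - ∫ y, h y) := by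
  have hrefl : ∫ y, h y * gaussK σ (x + y) = ∫ y, h y * gaussK σ (x - y) := by
    rw [← integral_neg_eq_self]
    refine integral_congr_ae ?_
    filter_upwards [hsymm] with y hy
    rw [hy, ← sub_eq_add_neg]
  have hsum : (∫ y, h y * gaussK σ (x - y)) + ∫ y, h y * gaussK σ (x + y)
      = 2 * gaussK σ x * ∫ y, h y * coshKernel σ x y := by
    rw [← integral_add (integrable_mul_gaussK hint σ (by fun_prop))
      (integrable_mul_gaussK hint σ (by fun_prop)), ← integral_const_mul]
    refine integral_congr_ae (Eventually.of_forall fun y => ?_)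
    simp only [← mul_add, gaussK_add_gaussK hσ]
    ring
  unfold Qfun
  linear_combination hsum / 2 - hrefl / 2

/-- The symmetrized transform exceeds every level at some positive point. -/
lemma exists_lt_integral_mul_coshKernel {h : ℝ → ℝ} (hint : Integrable h)
    (hnonneg : ∀ᵐ x : ℝ, 0 ≤ h x) (hpos : 0 < ∫ x : ℝ, h x) {σ : ℝ} (hσ : 0 < σ) (a : ℝ) :
    ∃ x : ℝ, 0 < x ∧ a < ∫ y, h y * coshKernel σ x y := by
  set F : ℝ → ℝ := fun x => ∫ y, h y * coshKernel σ x y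
  have hI := integrable_mul_coshKernel hint hσ
  have h01 : F 0 < F 1 := integral_mul_lt_integral_mul hnonneg hpos (hI 0) (hI 1) <| by
    filter_upwards [volume.ae_ne (0 : ℝ)] with y hy
    exact coshKernel_lt_coshKernel hσ hy (by simp)
  have hdouble (x : ℝ) : 2 * F x ≤ F (2 * x) + F 0 := by
    simp only [F]
    rw [← integral_add (hI _) (hI _), ← integral_const_mul]
    refine integral_mono_ae ((hI x).const_mul 2) ((hI _).add (hI _)) ?_
    filter_upwards [hnonneg] with y hy
    have := mul_le_mul_of_nonneg_left (two_mul_coshKernel_le σ x y) hy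
    linarith
  have hpow (n : ℕ) : 2 ^ n * (F 1 - F 0) ≤ F (2 ^ n) - F 0 := by
    induction n with
    | zero => simp
    | succ n ih =>
      have := hdouble (2 ^ n)
      rw [pow_succ' (2 : ℝ) n]
      linarith
  obtain ⟨n, hn⟩ := pow_unbounded_of_one_lt ((a - F 0) / (F 1 - F 0)) (one_lt_two (α := ℝ))
  refine ⟨2 ^ n, by positivity, ?_⟩
  rw [div_lt_iff₀ (sub_pos.2 h01)] at hn
  change a < F (2 ^ n)
  linarith [hpow n]

/-- **Lemma 13**: for `h̃` integrable, a.e. nonnegative and symmetric with positive total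
mass, the function `x ↦ Q(x,σ)` has exactly two zeros for each `σ > 0`: it is negative
between them and positive outside them. -/
theorem Q_two_zeros (h : ℝ → ℝ) (hint : Integrable h)
    (hnonneg : ∀ᵐ x : ℝ, 0 ≤ h x) (hsymm : ∀ᵐ x : ℝ, h (-x) = h x)
    (hpos : 0 < ∫ x : ℝ, h x) :
    ∀ σ : ℝ, 0 < σ →
      ∃ x₁ x₂ : ℝ, x₁ < x₂ ∧ Qfun h x₁ σ = 0 ∧ Qfun h x₂ σ = 0 ∧
        (∀ x ∈ Set.Ioo x₁ x₂, Qfun h x σ < 0) ∧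
        (∀ x : ℝ, x < x₁ → 0 < Qfun h x σ) ∧
        (∀ x : ℝ, x₂ < x → 0 < Qfun h x σ) := by
  intro σ hσ
  set F : ℝ → ℝ := fun x => ∫ y, h y * coshKernel σ x y
  have hI := integrable_mul_coshKernel hint hσ
  have hne : ∀ᵐ y : ℝ, y ≠ 0 := volume.ae_ne 0
  have hQ : ∀ x, Qfun h x σ = gaussK σ x * (F x - ∫ y, h y) := Qfun_eq_gaussK_mul hint hsymm hσ
  have hmono {x x' : ℝ} (hx : |x| < |x'|) : F x < F x' :=
    integral_mul_lt_integral_mul hnonneg hpos (hI x) (hI x')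
      (hne.mono fun y hy => coshKernel_lt_coshKernel hσ hy hx)
  have hF0 : F 0 < ∫ y, h y := by
    have := integral_mul_lt_integral_mul hnonneg hpos (hI 0) (g := fun _ => 1) (by simpa using hint)
      (hne.mono fun y hy => coshKernel_zero_lt_one hσ hy)
    simpa using this
  obtain ⟨b, hb, hFb⟩ := exists_lt_integral_mul_coshKernel hint hnonneg hpos hσ (∫ y, h y)
  obtain ⟨c, hc, hQc⟩ : ∃ c ∈ Set.Ioo 0 b, Qfun h c σ = 0 := by
    refine intermediate_value_Ioo hb.le (continuous_Qfun hint σ).continuousOn ⟨?_, ?_⟩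
    · rw [hQ]
      exact mul_neg_of_pos_of_neg (gaussK_pos hσ 0) (sub_neg.2 hF0)
    · rw [hQ]
      exact mul_pos (gaussK_pos hσ b) (sub_pos.2 hFb)
  have hc0 : 0 < c := hc.1
  have hFc : F c = ∫ y, h y := by
    rw [hQ] at hQc
    exact sub_eq_zero.1 ((mul_eq_zero.1 hQc).resolve_left (gaussK_pos hσ c).ne')
  have hneg {x : ℝ} (hx : |x| < |c|) : Qfun h x σ < 0 := by
    rw [hQ, ← hFc]
    exact mul_neg_of_pos_of_neg (gaussK_pos hσ x) (sub_neg.2 (hmono hx))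
  have hgt {x : ℝ} (hx : |c| < |x|) : 0 < Qfun h x σ := by
    rw [hQ, ← hFc]
    exact mul_pos (gaussK_pos hσ x) (sub_pos.2 (hmono hx))
  have hFneg : F (-c) = F c := by simp [F, coshKernel, neg_div]
  refine ⟨-c, c, by linarith, ?_, hQc, fun x hx => hneg ?_, fun x hx => hgt ?_, fun x hx => hgt ?_⟩
  · rw [hQ, hFneg, hFc, sub_self, mul_zero]
  · rw [abs_of_pos hc0]
    exact abs_lt.2 hx
  · rw [abs_of_pos hc0]
    exact lt_abs.2 (Or.inr (by linarith))
  · rw [abs_of_pos hc0]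
    exact lt_abs.2 (Or.inl hx)
end
end
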